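/- Let 0 < s < 1/2 < s' and A ⊆ ℝ^d bounded with m(τ) := μ{x∈A,y∉A: |x-y|<τ} ≤ C τ^{d+1} for all τ. If f ∈ C^{s'}(A) ∩ L^∞(A), then the extension f·1_A by zero satisfies [f·1_A]_{H^s}² ≤ C(d,s,s')·( ‖f‖_{L^∞}² · |A|^{1-2s} + [f]_{C^{s'}}² · |A|^{1-2(s-s')/d} ). -/

import Mathlib

open MeasureTheory

/-- The constant in the dyadic shell estimates for powers of a function. -/
noncomputable def shellConst (a e q : ℝ) : ℝ := 4 ^ |e| * 2 ^ (a + e) / (1 - q ^ (a + e))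

theorem shellConst_pos {a e q : ℝ} (hq : q ^ (a + e) < 1) : 0 < shellConst a e q := by
  have : 0 < 1 - q ^ (a + e) := by linarith
  unfold shellConst
  positivity

theorem rpow_le_of_mem_shell {r t : ℝ} (e : ℝ) (ht : 0 < t) (h1 : t / 4 ≤ r) (h2 : r ≤ t) :
    r ^ e ≤ 4 ^ |e| * t ^ e := by
  have hr : 0 < r := by linarith
  rcases le_total 0 e with he | he
  · calc r ^ e ≤ t ^ e := Real.rpow_le_rpow hr.le h2 he
      _ ≤ 4 ^ |e| * t ^ e :=
        le_mul_of_one_le_left (by positivity) (Real.one_le_rpow (by norm_num) (abs_nonneg e))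
  · calc r ^ e ≤ (t / 4) ^ e := Real.rpow_le_rpow_of_nonpos (by positivity) h1 he
      _ = 4 ^ |e| * t ^ e := by
        rw [Real.div_rpow ht.le (by norm_num), abs_of_nonpos he, Real.rpow_neg (by norm_num)]
        field_simp

section Shells

variable {α : Type*} [MeasurableSpace α] {μ : Measure α} {r : α → ℝ} {S : Set α}
  {ρ a e q D : ℝ}

theorem setLIntegral_rpow_le_of_shells (hr : Measurable r) (hS : MeasurableSet S)
    (hρ : 0 < ρ) (hq : 0 < q) (hq1 : q ^ (a + e) < 1) (hD : 0 ≤ D)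
    (hμ : ∀ τ > 0, μ {x | r x < τ} ≤ ENNReal.ofReal (D * τ ^ a))
    (hcov : ∀ x ∈ S, ∃ k : ℕ, 2 * ρ * q ^ k / 4 ≤ r x ∧ r x < 2 * ρ * q ^ k) :
    ∫⁻ x in S, ENNReal.ofReal (r x ^ e) ∂μ
      ≤ ENNReal.ofReal (shellConst a e q * D * ρ ^ (a + e)) := by
  set t : ℕ → ℝ := fun k => 2 * ρ * q ^ k with ht
  have htpos : ∀ k, 0 < t k := fun k => by simp only [ht]; positivity
  set c : ℕ → ENNReal := fun k => ENNReal.ofReal (4 ^ |e| * t k ^ e) with hc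
  have hmeas : ∀ k, MeasurableSet {x | r x < t k} := fun k => measurableSet_lt hr measurable_const
  have hterm : ∀ k, 4 ^ |e| * t k ^ e * (D * t k ^ a)
      = 4 ^ |e| * D * (2 * ρ) ^ (a + e) * (q ^ (a + e)) ^ k := by
    intro k
    have h1 : t k ^ e * t k ^ a = t k ^ (a + e) := by
      rw [← Real.rpow_add (htpos k), add_comm]
    have h2 : t k ^ (a + e) = (2 * ρ) ^ (a + e) * (q ^ (a + e)) ^ k := by
      simp only [ht]
      rw [Real.mul_rpow (by positivity) (by positivity), Real.rpow_pow_comm hq.le]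
    linear_combination (4 ^ |e| * D) * (h1.trans h2)
  have hq0 : 0 ≤ q ^ (a + e) := by positivity
  calc ∫⁻ x in S, ENNReal.ofReal (r x ^ e) ∂μ
      ≤ ∫⁻ x in S, ∑' k, {x | r x < t k}.indicator (fun _ => c k) x ∂μ := by
        refine setLIntegral_mono' hS fun x hx => ?_
        obtain ⟨k, hk1, hk2⟩ := hcov x hx
        refine le_trans ?_ (ENNReal.le_tsum k)
        rw [Set.indicator_of_mem (show x ∈ {x | r x < t k} from hk2)]
        exact ENNReal.ofReal_le_ofReal (rpow_le_of_mem_shell e (htpos k) hk1 hk2.le)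
    _ ≤ ∫⁻ x, ∑' k, {x | r x < t k}.indicator (fun _ => c k) x ∂μ := setLIntegral_le_lintegral _ _
    _ = ∑' k, c k * μ {x | r x < t k} := by
        rw [lintegral_tsum fun k => (measurable_const.indicator (hmeas k)).aemeasurable]
        exact tsum_congr fun k => lintegral_indicator_const (hmeas k) _
    _ ≤ ∑' k, ENNReal.ofReal (4 ^ |e| * D * (2 * ρ) ^ (a + e) * (q ^ (a + e)) ^ k) := by
        refine ENNReal.tsum_le_tsum fun k => ?_
        refine (mul_le_mul_right (hμ _ (htpos k)) _).trans_eq ?_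
        have := htpos k
        rw [hc, ← ENNReal.ofReal_mul (by positivity), hterm]
    _ = ENNReal.ofReal (shellConst a e q * D * ρ ^ (a + e)) := by
        rw [← ENNReal.ofReal_tsum_of_nonneg (fun k => by positivity)
          ((summable_geometric_of_lt_one hq0 hq1).mul_left _), tsum_mul_left,
          tsum_geometric_of_lt_one hq0 hq1, Real.mul_rpow (by norm_num) hρ.le, shellConst]
        congr 1
        ring

theorem setLIntegral_rpow_near_le (hr : Measurable r) (hρ : 0 < ρ) (hae : 0 < a + e) (hD : 0 ≤ D)
    (hμ : ∀ τ > 0, μ {x | r x < τ} ≤ ENNReal.ofReal (D * τ ^ a)) :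
    ∫⁻ x in {x | 0 < r x ∧ r x < ρ}, ENNReal.ofReal (r x ^ e) ∂μ
      ≤ ENNReal.ofReal (shellConst a e (1 / 2) * D * ρ ^ (a + e)) := by
  refine setLIntegral_rpow_le_of_shells hr
    ((measurableSet_lt measurable_const hr).inter (measurableSet_lt hr measurable_const)) hρ
    (by norm_num) (Real.rpow_lt_one (by norm_num) (by norm_num) hae) hD hμ ?_
  rintro x ⟨hx0, hx1⟩
  obtain ⟨k, hk1, hk2⟩ := exists_nat_pow_near_of_lt_one (div_pos hx0 hρ)
    ((div_le_one hρ).2 hx1.le) (show (0 : ℝ) < 1 / 2 by norm_num) (by norm_num)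
  rw [lt_div_iff₀ hρ, pow_succ] at hk1
  rw [div_le_iff₀ hρ] at hk2
  have : 0 < (1 / 2 : ℝ) ^ k * ρ := by positivity
  exact ⟨k, by linarith, by linarith⟩

theorem setLIntegral_rpow_far_le (hr : Measurable r) (hρ : 0 < ρ) (hae : a + e < 0) (hD : 0 ≤ D)
    (hμ : ∀ τ > 0, μ {x | r x < τ} ≤ ENNReal.ofReal (D * τ ^ a)) :
    ∫⁻ x in {x | ρ ≤ r x}, ENNReal.ofReal (r x ^ e) ∂μ
      ≤ ENNReal.ofReal (shellConst a e 2 * D * ρ ^ (a + e)) := by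
  refine setLIntegral_rpow_le_of_shells hr (measurableSet_le measurable_const hr) hρ
    (by norm_num) (Real.rpow_lt_one_of_one_lt_of_neg (by norm_num) hae) hD hμ ?_
  intro x hx
  obtain ⟨k, hk1, hk2⟩ := exists_nat_pow_near ((one_le_div hρ).2 hx) (show (1 : ℝ) < 2 by norm_num)
  rw [le_div_iff₀ hρ] at hk1
  rw [div_lt_iff₀ hρ, pow_succ] at hk2
  have : 0 < (2 : ℝ) ^ k * ρ := by positivity
  exact ⟨k, by linarith, by linarith⟩

end Shells

section Euclidean

variable {d : ℕ} {A : Set (EuclideanSpace ℝ (Fin d))}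

theorem volume_fst_mem_dist_lt (hA : MeasurableSet A) {τ : ℝ} (hτ : 0 < τ) :
    (volume : Measure (EuclideanSpace ℝ (Fin d) × EuclideanSpace ℝ (Fin d)))
      {p | p.1 ∈ A ∧ dist p.1 p.2 < τ}
      = volume A * (ENNReal.ofReal (τ ^ d) *
          volume (Metric.ball (0 : EuclideanSpace ℝ (Fin d)) 1)) := by
  have hm : MeasurableSet {p : EuclideanSpace ℝ (Fin d) × EuclideanSpace ℝ (Fin d) |
      p.1 ∈ A ∧ dist p.1 p.2 < τ} :=
    (measurable_fst hA).inter (measurableSet_lt measurable_dist measurable_const)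
  rw [Measure.volume_eq_prod, Measure.prod_apply hm]
  have h : ∀ x : EuclideanSpace ℝ (Fin d),
      volume (Prod.mk x ⁻¹' {p : EuclideanSpace ℝ (Fin d) × EuclideanSpace ℝ (Fin d) |
        p.1 ∈ A ∧ dist p.1 p.2 < τ})
      = A.indicator (fun _ => ENNReal.ofReal (τ ^ d) *
          volume (Metric.ball (0 : EuclideanSpace ℝ (Fin d)) 1)) x := by
    intro x
    by_cases hx : x ∈ A
    · rw [Set.indicator_of_mem hx]
      have : Prod.mk x ⁻¹' {p : EuclideanSpace ℝ (Fin d) × EuclideanSpace ℝ (Fin d) |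
          p.1 ∈ A ∧ dist p.1 p.2 < τ} = Metric.ball x τ := by
        ext y
        simp [hx, dist_comm]
      rw [this, Measure.addHaar_ball_of_pos _ _ hτ, finrank_euclideanSpace_fin]
    · simp [hx]
  rw [lintegral_congr h, lintegral_indicator_const hA, mul_comm]

/-- An isoperimetric consequence of a boundary layer estimate. -/
theorem volume_rpow_le_of_boundary_layer (hd : 1 ≤ d) {C v ω : ℝ} (hA : MeasurableSet A)
    (hC : 0 < C) (hv : 0 < v) (hω : 0 < ω) (hvA : volume A = ENNReal.ofReal v)
    (hωB : volume (Metric.ball (0 : EuclideanSpace ℝ (Fin d)) 1) = ENNReal.ofReal ω)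
    (hm : ∀ τ > 0,
        (volume : Measure (EuclideanSpace ℝ (Fin d) × EuclideanSpace ℝ (Fin d)))
          {p | p.1 ∈ A ∧ p.2 ∉ A ∧ dist p.1 p.2 < τ} ≤ ENNReal.ofReal (C * τ ^ ((d : ℝ) + 1))) :
    v ^ (1 - 1 / (d : ℝ)) ≤ C * (2 / ω) ^ (1 + 1 / (d : ℝ)) := by
  have hd0 : (0 : ℝ) < d := by exact_mod_cast hd
  set τ : ℝ := (2 * v / ω) ^ (1 / (d : ℝ)) with hτdef
  have hτ : 0 < τ := by positivity
  have hτd : τ ^ d = 2 * v / ω := by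
    rw [hτdef, one_div, Real.rpow_inv_natCast_pow (by positivity) (by omega)]
  have hτd1 : τ ^ ((d : ℝ) + 1) = (2 / ω) ^ (1 + 1 / (d : ℝ)) * v ^ (1 + 1 / (d : ℝ)) := by
    rw [hτdef, ← Real.rpow_mul (by positivity), ← Real.mul_rpow (by positivity) hv.le]
    congr 1
    · ring
    · field_simp
  have hsub : {p : EuclideanSpace ℝ (Fin d) × EuclideanSpace ℝ (Fin d) |
      p.1 ∈ A ∧ dist p.1 p.2 < τ}
      ⊆ {p | p.1 ∈ A ∧ p.2 ∉ A ∧ dist p.1 p.2 < τ} ∪ A ×ˢ A := by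
    rintro p ⟨h1, h2⟩
    by_cases h : p.2 ∈ A
    · exact Or.inr ⟨h1, h⟩
    · exact Or.inl ⟨h1, h, h2⟩
  have key := (measure_mono (μ := volume) hsub).trans
    ((measure_union_le _ _).trans (add_le_add_left (hm τ hτ) _))
  rw [volume_fst_mem_dist_lt hA hτ, Measure.volume_eq_prod, Measure.prod_prod, hvA, hωB,
    ← ENNReal.ofReal_mul (by positivity), ← ENNReal.ofReal_mul hv.le, ← ENNReal.ofReal_mul hv.le,
    ← ENNReal.ofReal_add (by positivity) (by positivity),
    ENNReal.ofReal_le_ofReal_iff (by positivity), hτd, hτd1] at key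
  have h1 : v * (2 * v / ω * ω) = 2 * (v * v) := by field_simp
  have h2 : v ^ (1 - 1 / (d : ℝ)) * v ^ (1 + 1 / (d : ℝ)) = v * v := by
    rw [← Real.rpow_add hv, show 1 - 1 / (d : ℝ) + (1 + 1 / (d : ℝ)) = 2 by ring]
    norm_num [sq]
  refine le_of_mul_le_mul_right ?_ (show 0 < v ^ (1 + 1 / (d : ℝ)) by positivity)
  linarith

theorem ofReal_indicator_sub_sq_div_le {s s' v M H : ℝ} {f : EuclideanSpace ℝ (Fin d) → ℝ}
    (hfM : ∀ x ∈ A, |f x| ≤ M)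
    (hfH : ∀ x ∈ A, ∀ y ∈ A, |f x - f y| ≤ H * dist x y ^ s')
    {u : EuclideanSpace ℝ (Fin d) × EuclideanSpace ℝ (Fin d) → ENNReal}
    (huB : ∀ p, p.1 ∈ A → p.2 ∉ A → 0 < dist p.1 p.2 → dist p.1 p.2 < v →
      ENNReal.ofReal (M ^ 2) * ENNReal.ofReal (dist p.1 p.2 ^ (-((d : ℝ) + 2 * s))) ≤ u p)
    (huF : ∀ p, p.1 ∈ A → v ≤ dist p.1 p.2 →
      ENNReal.ofReal (4 * M ^ 2) * ENNReal.ofReal (dist p.1 p.2 ^ (-((d : ℝ) + 2 * s))) ≤ u p)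
    (huN : ∀ p, p.1 ∈ A → 0 < dist p.1 p.2 → dist p.1 p.2 < v →
      ENNReal.ofReal (H ^ 2) *
        ENNReal.ofReal (dist p.1 p.2 ^ (2 * (s' - s) - (d : ℝ))) ≤ u p)
    (x y : EuclideanSpace ℝ (Fin d)) :
    ENNReal.ofReal
      (|Set.indicator A f x - Set.indicator A f y| ^ 2 / dist x y ^ ((d : ℝ) + 2 * s))
      ≤ u (x, y) + u (y, x) := by
  rcases eq_or_ne x y with rfl | hxy
  · simp
  have hr : 0 < dist x y := dist_pos.2 hxy
  have hdiv : ∀ z, z / dist x y ^ ((d : ℝ) + 2 * s)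
      = z * dist x y ^ (-((d : ℝ) + 2 * s)) := fun z => by
    rw [Real.rpow_neg hr.le, div_eq_mul_inv]
  rw [hdiv]
  have hmul : ∀ z b c : ℝ, 0 ≤ b → z ≤ b * c →
      ENNReal.ofReal z ≤ ENNReal.ofReal b * ENNReal.ofReal c := fun z b c hb h => by
    rw [← ENNReal.ofReal_mul hb]
    exact ENNReal.ofReal_le_ofReal h
  have hk : 0 < dist x y ^ (-((d : ℝ) + 2 * s)) := by positivity
  by_cases hx : x ∈ A <;> by_cases hy : y ∈ A
  · rw [Set.indicator_of_mem hx, Set.indicator_of_mem hy]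
    refine le_add_right ?_
    rcases lt_or_ge (dist x y) v with h | h
    · refine (hmul _ _ _ (by positivity) ?_).trans (huN (x, y) hx hr h)
      have h1 : dist x y ^ (2 * (s' - s) - (d : ℝ))
          = (dist x y ^ s') ^ 2 * dist x y ^ (-((d : ℝ) + 2 * s)) := by
        rw [← Real.rpow_mul_natCast hr.le, ← Real.rpow_add hr]
        congr 1
        push_cast
        ring
      rw [h1, ← mul_assoc, ← mul_pow]
      have := hfH x hx y hy
      gcongr
    · refine (hmul _ _ _ (by positivity) ?_).trans (huF (x, y) hx h)
      have h1 : |f x - f y| ≤ 2 * M :=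
        (abs_sub _ _).trans (by linarith [hfM x hx, hfM y hy])
      rw [show 4 * M ^ 2 = (2 * M) ^ 2 by ring]
      gcongr
  · rw [Set.indicator_of_mem hx, Set.indicator_of_notMem hy, sub_zero]
    refine le_add_right ?_
    have h1 := pow_le_pow_left₀ (abs_nonneg _) (hfM x hx) 2
    rcases lt_or_ge (dist x y) v with h | h
    · exact (hmul _ _ _ (by positivity) (by gcongr)).trans (huB (x, y) hx hy hr h)
    · exact (hmul _ _ _ (by positivity) (by gcongr; nlinarith)).trans (huF (x, y) hx h)
  · rw [Set.indicator_of_mem hy, Set.indicator_of_notMem hx, zero_sub, abs_neg]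
    refine le_add_left ?_
    rw [dist_comm x y] at hr hk ⊢
    have h1 := pow_le_pow_left₀ (abs_nonneg _) (hfM y hy) 2
    rcases lt_or_ge (dist y x) v with h | h
    · exact (hmul _ _ _ (by positivity) (by gcongr)).trans (huB (y, x) hy hx hr h)
    · exact (hmul _ _ _ (by positivity) (by gcongr; nlinarith)).trans (huF (y, x) hy h)
  · simp [hx, hy]

theorem lintegral_lintegral_le_two_mul {α : Type*} [MeasurableSpace α] {μ : Measure α} [SFinite μ]
    {F : α → α → ENNReal} {u : α × α → ENNReal} (hu : Measurable u)
    (hF : ∀ x y, F x y ≤ u (x, y) + u (y, x)) :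
    ∫⁻ x, ∫⁻ y, F x y ∂μ ∂μ ≤ 2 * ∫⁻ p, u p ∂(μ.prod μ) := by
  calc ∫⁻ x, ∫⁻ y, F x y ∂μ ∂μ ≤ ∫⁻ x, ∫⁻ y, (u (x, y) + u (y, x)) ∂μ ∂μ :=
        lintegral_mono fun x => lintegral_mono fun y => hF x y
    _ = ∫⁻ p, (u p + u p.swap) ∂(μ.prod μ) := by
        exact (lintegral_prod (fun p => u p + u p.swap)
          (hu.add (hu.comp measurable_swap)).aemeasurable).symm
    _ = 2 * ∫⁻ p, u p ∂(μ.prod μ) := by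
        rw [lintegral_add_left hu, lintegral_prod_swap, two_mul]

end Euclidean

theorem stmt4 (d : ℕ) (hd : 1 ≤ d) (s s' C : ℝ)
    (hs0 : 0 < s) (hs : s < 1/2) (hs' : 1/2 < s') (hC : 0 < C) :
    ∃ C' > 0, ∀ A : Set (EuclideanSpace ℝ (Fin d)),
      MeasurableSet A → Bornology.IsBounded A → volume A < ⊤ →
      (∀ τ > 0,
        (volume : Measure (EuclideanSpace ℝ (Fin d) × EuclideanSpace ℝ (Fin d)))
          {p | p.1 ∈ A ∧ p.2 ∉ A ∧ dist p.1 p.2 < τ} ≤ ENNReal.ofReal (C * τ ^ ((d : ℝ) + 1))) →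
      ∀ (f : EuclideanSpace ℝ (Fin d) → ℝ) (M Hf : ℝ), 0 ≤ M → 0 ≤ Hf →
      (∀ x ∈ A, |f x| ≤ M) →
      (∀ x ∈ A, ∀ y ∈ A, |f x - f y| ≤ Hf * dist x y ^ s') →
      (∫⁻ x, ∫⁻ y, ENNReal.ofReal
          (|Set.indicator A f x - Set.indicator A f y| ^ 2 / dist x y ^ ((d : ℝ) + 2 * s)))
        ≤ ENNReal.ofReal
            (C' * (M ^ 2 * (volume A).toReal ^ (1 - 2 * s)
              + Hf ^ 2 * (volume A).toReal ^ (1 - 2 * (s - s') / d))) := by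
  have hd0 : (0 : ℝ) < d := by exact_mod_cast hd
  obtain ⟨ω, hω, hωB⟩ : ∃ ω : ℝ, 0 < ω ∧
      volume (Metric.ball (0 : EuclideanSpace ℝ (Fin d)) 1) = ENNReal.ofReal ω :=
    ⟨_, ENNReal.toReal_pos (Metric.measure_ball_pos _ _ one_pos).ne' measure_ball_lt_top.ne,
      (ENNReal.ofReal_toReal measure_ball_lt_top.ne).symm⟩
  set K₁ := shellConst (d + 1) (-((d : ℝ) + 2 * s)) (1 / 2) with hK₁
  set K₂ := shellConst d (-((d : ℝ) + 2 * s)) 2 with hK₂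
  set K₃ := shellConst d (2 * (s' - s) - (d : ℝ)) (1 / 2) with hK₃
  have hK₁p : 0 < K₁ := shellConst_pos
    (Real.rpow_lt_one (by norm_num) (by norm_num) (by linarith))
  have hK₂p : 0 < K₂ := shellConst_pos
    (Real.rpow_lt_one_of_one_lt_of_neg (by norm_num) (by linarith))
  have hK₃p : 0 < K₃ := shellConst_pos
    (Real.rpow_lt_one (by norm_num) (by norm_num) (by linarith))
  set L := (C * (2 / ω) ^ (1 + 1 / (d : ℝ))) ^ (2 * (s' - s)) with hL
  have hLp : 0 < L := by positivity
  refine ⟨2 * (K₁ * C + 4 * (K₂ * ω) + K₃ * ω * L), by positivity, ?_⟩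
  intro A hA _ hAfin hm f M H hM hH hfM hfH
  rcases eq_or_ne (volume A) 0 with h0 | h0
  · have hae : ∀ᵐ x : EuclideanSpace ℝ (Fin d), Set.indicator A f x = 0 := by
      filter_upwards [measure_eq_zero_iff_ae_notMem.1 h0] with x hx
      simp [hx]
    have : (∫⁻ x, ∫⁻ y, ENNReal.ofReal
          (|Set.indicator A f x - Set.indicator A f y| ^ 2 / dist x y ^ ((d : ℝ) + 2 * s))) = 0 := by
      rw [← lintegral_zero (μ := (volume : Measure (EuclideanSpace ℝ (Fin d))))]
      refine lintegral_congr_ae ?_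
      filter_upwards [hae] with x hx
      rw [← lintegral_zero (μ := (volume : Measure (EuclideanSpace ℝ (Fin d))))]
      refine lintegral_congr_ae ?_
      filter_upwards [hae] with y hy
      simp [hx, hy]
    rw [this]
    exact zero_le
  set v := (volume A).toReal with hv
  have hvp : 0 < v := ENNReal.toReal_pos h0 hAfin.ne
  have hvA : volume A = ENNReal.ofReal v := (ENNReal.ofReal_toReal hAfin.ne).symm
  have hiso := volume_rpow_le_of_boundary_layer hd hA hC hvp hω hvA hωB hm
  let X := EuclideanSpace ℝ (Fin d)
  let r : X × X → ℝ := fun p => dist p.1 p.2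
  have hr : Measurable r := measurable_dist
  let SB : Set (X × X) := {p | p.1 ∈ A ∧ p.2 ∉ A}
  let SA : Set (X × X) := {p | p.1 ∈ A}
  let Near : Set (X × X) := {p | 0 < r p ∧ r p < v}
  let Far : Set (X × X) := {p | v ≤ r p}
  have hSA : MeasurableSet SA := measurable_fst hA
  have hSB : MeasurableSet SB := hSA.inter (measurable_snd hA.compl)
  have hNear : MeasurableSet Near :=
    (measurableSet_lt measurable_const hr).inter (measurableSet_lt hr measurable_const)
  have hFar : MeasurableSet Far := measurableSet_le measurable_const hr
  let k : ℝ → X × X → ENNReal := fun e p => ENNReal.ofReal (r p ^ e)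
  have hk : ∀ e, Measurable (k e) := fun e => (hr.pow_const e).ennreal_ofReal
  have hlayerB : ∀ τ > 0, (volume.restrict SB) {p | r p < τ}
      ≤ ENNReal.ofReal (C * τ ^ ((d : ℝ) + 1)) := by
    intro τ hτ
    rw [Measure.restrict_apply (measurableSet_lt hr measurable_const)]
    refine le_trans (measure_mono ?_) (hm τ hτ)
    rintro p ⟨h1, h2, h3⟩
    exact ⟨h2, h3, h1⟩
  have hlayerA : ∀ τ > 0, (volume.restrict SA) {p | r p < τ}
      ≤ ENNReal.ofReal (v * ω * τ ^ (d : ℝ)) := by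
    intro τ hτ
    rw [Measure.restrict_apply (measurableSet_lt hr measurable_const)]
    refine (measure_mono ?_).trans_eq ((volume_fst_mem_dist_lt hA hτ).trans ?_)
    · rintro p ⟨h1, h2⟩
      exact ⟨h2, h1⟩
    · rw [hvA, hωB, ← ENNReal.ofReal_mul (by positivity), ← ENNReal.ofReal_mul hvp.le,
        Real.rpow_natCast]
      congr 1
      ring
  have hB := setLIntegral_rpow_near_le (e := -((d : ℝ) + 2 * s)) hr hvp (by linarith) hC.le hlayerB
  have hF := setLIntegral_rpow_far_le (e := -((d : ℝ) + 2 * s)) hr hvp (by linarith)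
    (by positivity) hlayerA
  have hN := setLIntegral_rpow_near_le (e := 2 * (s' - s) - (d : ℝ)) hr hvp (by linarith)
    (by positivity) hlayerA
  rw [Measure.restrict_restrict hNear] at hB hN
  rw [Measure.restrict_restrict hFar] at hF
  let uB : X × X → ENNReal :=
    (Near ∩ SB).indicator fun p => ENNReal.ofReal (M ^ 2) * k (-((d : ℝ) + 2 * s)) p
  let uF : X × X → ENNReal :=
    (Far ∩ SA).indicator fun p => ENNReal.ofReal (4 * M ^ 2) * k (-((d : ℝ) + 2 * s)) p
  let uN : X × X → ENNReal :=
    (Near ∩ SA).indicator fun p => ENNReal.ofReal (H ^ 2) * k (2 * (s' - s) - (d : ℝ)) p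
  have huB : Measurable uB := ((hk _).const_mul _).indicator (hNear.inter hSB)
  have huF : Measurable uF := ((hk _).const_mul _).indicator (hFar.inter hSA)
  have huN : Measurable uN := ((hk _).const_mul _).indicator (hNear.inter hSA)
  have hpt := ofReal_indicator_sub_sq_div_le (u := fun p => uB p + uF p + uN p) (v := v)
    hfM hfH
    (fun p h1 h2 h3 h4 => le_add_right (le_add_right
      (Set.indicator_of_mem (show p ∈ Near ∩ SB from ⟨⟨h3, h4⟩, h1, h2⟩)
        fun p => ENNReal.ofReal (M ^ 2) * k (-((d : ℝ) + 2 * s)) p).ge))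
    (fun p h1 h2 => le_add_right (le_add_left
      (Set.indicator_of_mem (show p ∈ Far ∩ SA from ⟨h2, h1⟩)
        fun p => ENNReal.ofReal (4 * M ^ 2) * k (-((d : ℝ) + 2 * s)) p).ge))
    (fun p h1 h2 h3 => le_add_left
      (Set.indicator_of_mem (show p ∈ Near ∩ SA from ⟨⟨h2, h3⟩, h1⟩)
        fun p => ENNReal.ofReal (H ^ 2) * k (2 * (s' - s) - (d : ℝ)) p).ge)
  refine (lintegral_lintegral_le_two_mul (u := fun p => uB p + uF p + uN p)
    ((huB.add huF).add huN) hpt).trans ?_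
  rw [← Measure.volume_eq_prod,
    lintegral_add_left (f := fun p => uB p + uF p) (huB.add huF), lintegral_add_left huB,
    lintegral_indicator (hNear.inter hSB), lintegral_indicator (hFar.inter hSA),
    lintegral_indicator (hNear.inter hSA), lintegral_const_mul _ (hk _),
    lintegral_const_mul _ (hk _), lintegral_const_mul _ (hk _)]
  refine (mul_le_mul_right (add_le_add (add_le_add (mul_le_mul_right hB _)
    (mul_le_mul_right hF _)) (mul_le_mul_right hN _)) _).trans ?_
  rw [← hK₁, ← hK₂, ← hK₃, ← ENNReal.ofReal_mul (by positivity),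
    ← ENNReal.ofReal_mul (by positivity), ← ENNReal.ofReal_mul (by positivity),
    ← ENNReal.ofReal_add (by positivity) (by positivity),
    ← ENNReal.ofReal_add (by positivity) (by positivity),
    ← ENNReal.ofReal_ofNat 2, ← ENNReal.ofReal_mul (by positivity)]
  refine ENNReal.ofReal_le_ofReal ?_
  have e1 : v ^ ((d : ℝ) + 1 + -((d : ℝ) + 2 * s)) = v ^ (1 - 2 * s) := by
    congr 1
    ring
  have e2 : v * v ^ ((d : ℝ) + -((d : ℝ) + 2 * s)) = v ^ (1 - 2 * s) := by
    rw [← Real.rpow_one_add' hvp.le (by linarith)]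
    congr 1
    ring
  have e3 : v * v ^ ((d : ℝ) + (2 * (s' - s) - (d : ℝ)))
      ≤ L * v ^ (1 - 2 * (s - s') / d) := by
    calc v * v ^ ((d : ℝ) + (2 * (s' - s) - (d : ℝ)))
        = (v ^ (1 - 1 / (d : ℝ))) ^ (2 * (s' - s)) * v ^ (1 - 2 * (s - s') / d) := by
          rw [← Real.rpow_mul hvp.le, ← Real.rpow_add hvp,
            ← Real.rpow_one_add' hvp.le (by linarith)]
          congr 1
          field_simp
          ring
      _ ≤ L * v ^ (1 - 2 * (s - s') / d) := by
          have : 0 ≤ 2 * (s' - s) := by linarith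
          rw [hL]
          gcongr
  have hP : 0 ≤ M ^ 2 * v ^ (1 - 2 * s) := by positivity
  have hQ : 0 ≤ H ^ 2 * v ^ (1 - 2 * (s - s') / d) := by positivity
  have e4 := mul_le_mul_of_nonneg_left e3 (show 0 ≤ H ^ 2 * (K₃ * ω) by positivity)
  have e5 : 0 ≤ K₃ * ω * L * (M ^ 2 * v ^ (1 - 2 * s)) := by positivity
  have e6 : 0 ≤ (K₁ * C + 4 * (K₂ * ω)) * (H ^ 2 * v ^ (1 - 2 * (s - s') / d)) := by positivity
  rw [e1]
  have e7 : 4 * M ^ 2 * (K₂ * (v * ω) * v ^ ((d : ℝ) + -((d : ℝ) + 2 * s)))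
      = 4 * M ^ 2 * K₂ * ω * v ^ (1 - 2 * s) := by
    rw [← e2]
    ring
  rw [e7]
  linarith
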